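/- Let β ∈ (0,1/2) and s < t. The Fourier transform of the function D^β_-𝟙_{(s,t]}(u) := (1/Γ(1-β))[(t-u)₊^{-β} - (s-u)₊^{-β}] is given by y ↦ (iy)^β · (e^{ity} - e^{isy})/(iy) for y ≠ 0, i.e. F[D^β_-𝟙_{(s,t]}](y) = (iy)^β F[𝟙_{(s,t]}](y). -/

import Mathlib

open MeasureTheory

open Set Filter Topology

/-- Laplace transform of `x ^ (a - 1)` at a complex argument with positive real part. -/
theorem integral_rpow_mul_cexp_neg_mul_Ioi {a : ℝ} (ha : 0 < a) {z : ℂ} (hz : 0 < z.re) :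
    ∫ x in Ioi (0 : ℝ), ((x ^ (a - 1) : ℝ) : ℂ) * Complex.exp (-(z * x)) =
      z ^ (-a : ℂ) * (Real.Gamma a : ℂ) := by
  set d : ℝ → ENNReal := fun x ↦ ENNReal.ofReal (x ^ (a - 1)) with hd
  have hd_meas : Measurable d := by fun_prop
  set ν : Measure ℝ := (volume.restrict (Ioi 0)).withDensity d with hν
  have h_lap (w : ℂ) : ProbabilityTheory.complexMGF (fun x ↦ -x) ν w =
      ∫ x in Ioi (0 : ℝ), ((x ^ (a - 1) : ℝ) : ℂ) * Complex.exp (-(w * x)) := by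
    rw [ProbabilityTheory.complexMGF, hν, integral_withDensity_eq_integral_toReal_smul hd_meas
      (by simp [hd])]
    refine setIntegral_congr_fun measurableSet_Ioi fun x hx ↦ ?_
    have hx' : 0 ≤ x ^ (a - 1) := Real.rpow_nonneg (le_of_lt hx) _
    simp [hd, ENNReal.toReal_ofReal hx', Complex.exp_neg]
  have h_real (r : ℝ) (hr : 0 < r) :
      ∫ x in Ioi (0 : ℝ), ((x ^ (a - 1) : ℝ) : ℂ) * Complex.exp (-((r : ℂ) * x)) =
        (r : ℂ) ^ (-a : ℂ) * (Real.Gamma a : ℂ) := by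
    have h := Real.integral_rpow_mul_exp_neg_mul_Ioi ha hr
    rw [one_div, Real.inv_rpow hr.le, ← Real.rpow_neg hr.le] at h
    rw [← Complex.ofReal_neg, ← Complex.ofReal_cpow hr.le, ← Complex.ofReal_mul, ← h,
      ← integral_complex_ofReal]
    simp
  have h_int : Ioi 0 ⊆ interior (ProbabilityTheory.integrableExpSet (fun x ↦ -x) ν) := by
    refine interior_maximal (fun r hr ↦ ?_) isOpen_Ioi
    have hne : ∫ x in Ioi (0 : ℝ), x ^ (a - 1) * Real.exp (-(r * x)) ≠ 0 := by
      rw [Real.integral_rpow_mul_exp_neg_mul_Ioi ha hr]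
      have hr' : 0 < r := hr
      have := Real.Gamma_pos_of_pos ha
      positivity
    have h := Integrable.of_integral_ne_zero hne
    change Integrable _ ν
    rw [hν, integrable_withDensity_iff_integrable_smul₀' hd_meas.aemeasurable (by simp [hd])]
    refine (integrableOn_congr_fun (fun x hx ↦ ?_) measurableSet_Ioi).1 h
    have hx' : 0 ≤ x ^ (a - 1) := Real.rpow_nonneg (le_of_lt hx) _
    simp [hd, ENNReal.toReal_ofReal hx']
  have hU : IsOpen {w : ℂ | 0 < w.re} := isOpen_lt continuous_const Complex.continuous_re
  have hF : AnalyticOnNhd ℂ (ProbabilityTheory.complexMGF (fun x ↦ -x) ν)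
      {w : ℂ | 0 < w.re} := fun w hw ↦
    ProbabilityTheory.analyticAt_complexMGF (h_int hw)
  have hG : AnalyticOnNhd ℂ (fun w : ℂ ↦ w ^ (-a : ℂ) * (Real.Gamma a : ℂ))
      {w : ℂ | 0 < w.re} := fun w hw ↦
    (analyticAt_id.cpow analyticAt_const (Or.inl hw)).mul analyticAt_const
  have hfreq : ∃ᶠ w : ℂ in 𝓝[≠] (1 : ℂ),
      ProbabilityTheory.complexMGF (fun x ↦ -x) ν w =
        w ^ (-a : ℂ) * (Real.Gamma a : ℂ) := by
    have ht : Tendsto (fun r : ℝ ↦ (r : ℂ)) (𝓝[>] 1) (𝓝[≠] (1 : ℂ)) := by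
      refine tendsto_nhdsWithin_iff.2 ⟨?_, ?_⟩
      · exact (Complex.continuous_ofReal.tendsto' 1 1 (by simp)).mono_left nhdsWithin_le_nhds
      · filter_upwards [self_mem_nhdsWithin] with r hr
        simpa using (ne_of_gt hr : r ≠ 1)
    refine ht.frequently (Eventually.frequently ?_)
    filter_upwards [self_mem_nhdsWithin] with r hr
    rw [h_lap, h_real r (zero_lt_one.trans hr)]
  rw [← h_lap]
  exact hF.eqOn_of_preconnected_of_frequently_eq hG
    (convex_halfSpace_re_gt 0).isPreconnected (by simp) hfreq hz

theorem integrableOn_rpow_mul_cexp_neg_mul_Ioi {a : ℝ} (ha : 0 < a) {z : ℂ} (hz : 0 < z.re) :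
    IntegrableOn (fun x : ℝ ↦ ((x ^ (a - 1) : ℝ) : ℂ) * Complex.exp (-(z * x))) (Ioi 0) := by
  refine Integrable.of_integral_ne_zero ?_
  rw [integral_rpow_mul_cexp_neg_mul_Ioi ha hz]
  have hz0 : z ≠ 0 := by rintro rfl; simp at hz
  exact mul_ne_zero (by simp [Complex.cpow_eq_zero_iff, hz0])
    (by exact_mod_cast (Real.Gamma_pos_of_pos ha).ne')

theorem max_zero_rpow_eq_indicator {p : ℝ} (hp : p ≠ 0) (x : ℝ) :
    (max x 0) ^ p = (Ioi (0 : ℝ)).indicator (fun y ↦ y ^ p) x := by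
  rcases le_or_gt x 0 with hx | hx
  · simp [hx, Real.zero_rpow hp]
  · simp [hx, hx.le]

/-- The truncated power `(c - u)₊ ^ (-β)` against `exp (z * u)`, for `z` in the right half-plane. -/
theorem integrable_cexp_mul_max_sub_rpow {β : ℝ} (hβ0 : 0 < β) (hβ : β < 1) {z : ℂ}
    (hz : 0 < z.re) (c : ℝ) :
    Integrable (fun u : ℝ ↦ Complex.exp (z * u) * (((max (c - u) 0) ^ (-β) : ℝ) : ℂ)) ∧
    ∫ u : ℝ, Complex.exp (z * u) * (((max (c - u) 0) ^ (-β) : ℝ) : ℂ) =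
      Complex.exp (z * c) * (z ^ ((β - 1 : ℝ) : ℂ) * (Real.Gamma (1 - β) : ℂ)) := by
  set g : ℝ → ℂ := (Ioi (0 : ℝ)).indicator
    (fun x ↦ ((x ^ ((1 - β) - 1) : ℝ) : ℂ) * Complex.exp (-(z * x))) with hg
  have hfg : (fun u : ℝ ↦ Complex.exp (z * u) * (((max (c - u) 0) ^ (-β) : ℝ) : ℂ)) =
      fun u ↦ Complex.exp (z * c) * g (c - u) := by
    funext u
    rw [max_zero_rpow_eq_indicator (neg_ne_zero.2 hβ0.ne'), hg]
    by_cases hu : c - u ∈ Ioi (0 : ℝ)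
    · rw [indicator_of_mem hu, indicator_of_mem hu, mul_left_comm, ← Complex.exp_add, mul_comm]
      congr 3
      · ring_nf
      · push_cast; ring
    · rw [indicator_of_notMem hu, indicator_of_notMem hu]; simp
  have hgi : Integrable g := (integrable_indicator_iff measurableSet_Ioi).2
    (integrableOn_rpow_mul_cexp_neg_mul_Ioi (sub_pos.2 hβ) hz)
  rw [hfg]
  refine ⟨(hgi.comp_sub_left c).const_mul _, ?_⟩
  rw [integral_const_mul, integral_sub_left_eq_self g volume c, hg,
    integral_indicator measurableSet_Ioi,
    integral_rpow_mul_cexp_neg_mul_Ioi (sub_pos.2 hβ) hz]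
  congr 3
  push_cast
  ring

theorem rpow_neg_sub_rpow_neg_le {a b β : ℝ} (ha : 0 < a) (hab : a ≤ b) (hβ : 0 ≤ β) :
    a ^ (-β) - b ^ (-β) ≤ β * (b - a) * a ^ (-β - 1) := by
  have hb : 0 < b := ha.trans_le hab
  have hr : 0 < b / a := div_pos hb ha
  have h1 : 1 - β * (b / a - 1) ≤ (b / a) ^ (-β) := by
    rw [Real.rpow_def_of_pos hr]
    have h2 := Real.add_one_le_exp (Real.log (b / a) * -β)
    have h3 := mul_le_mul_of_nonneg_left (Real.log_le_sub_one_of_pos hr) hβ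
    linarith
  have h4 : b ^ (-β) = (b / a) ^ (-β) * a ^ (-β) := by
    rw [← Real.mul_rpow hr.le ha.le, div_mul_cancel₀ _ ha.ne']
  have h5 := mul_le_mul_of_nonneg_right h1 (Real.rpow_nonneg ha.le (-β))
  rw [Real.rpow_sub_one ha.ne', h4]
  have h6 : β * (b - a) * (a ^ (-β) / a) = β * (b / a - 1) * a ^ (-β) := by field_simp
  rw [h6]
  linarith

theorem integrable_max_add_rpow_sub_max_rpow {β d : ℝ} (hβ0 : 0 < β) (hβ : β < 1) (hd : 0 < d) :
    Integrable (fun v : ℝ ↦ (max (v + d) 0) ^ (-β) - (max v 0) ^ (-β)) := by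
  have hp (a b : ℝ) : IntervalIntegrable (fun v : ℝ ↦ (max v 0) ^ (-β)) volume a b := by
    have h := intervalIntegral.intervalIntegrable_rpow' (a := a) (b := b) (r := -β) (by linarith)
    rw [intervalIntegrable_iff] at h ⊢
    simp_rw [max_zero_rpow_eq_indicator (neg_ne_zero.2 hβ0.ne')]
    exact h.indicator measurableSet_Ioi
  have h_left : IntegrableOn (fun v : ℝ ↦ (max (v + d) 0) ^ (-β) - (max v 0) ^ (-β))
      (Iic (-d)) := by
    refine (integrableOn_congr_fun (fun v hv ↦ ?_) measurableSet_Iic).1 integrableOn_zero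
    have hv' : v ≤ -d := hv
    simp [max_eq_right (by linarith : v + d ≤ 0), max_eq_right (by linarith : v ≤ 0)]
  have h_mid : IntegrableOn (fun v : ℝ ↦ (max (v + d) 0) ^ (-β) - (max v 0) ^ (-β))
      (Ioc (-d) 1) := by
    rw [← intervalIntegrable_iff_integrableOn_Ioc_of_le (by linarith)]
    refine IntervalIntegrable.sub ?_ (hp _ _)
    simpa using (hp 0 (1 + d)).comp_add_right d
  have h_right : IntegrableOn (fun v : ℝ ↦ (max (v + d) 0) ^ (-β) - (max v 0) ^ (-β))
      (Ioi 1) := by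
    refine Integrable.mono' ((integrableOn_Ioi_rpow_of_lt (by linarith : -β - 1 < -1)
      zero_lt_one).const_mul (β * d)) (Measurable.aestronglyMeasurable (by fun_prop)) ?_
    filter_upwards [ae_restrict_mem measurableSet_Ioi] with v hv
    have hv0 : 0 < v := zero_lt_one.trans hv
    have h := rpow_neg_sub_rpow_neg_le hv0 (by linarith : v ≤ v + d) hβ0.le
    have h' : (v + d) ^ (-β) ≤ v ^ (-β) :=
      Real.rpow_le_rpow_of_nonpos hv0 (by linarith) (by linarith)
    rw [max_eq_left hv0.le, max_eq_left (by linarith : 0 ≤ v + d), Real.norm_eq_abs,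
      abs_of_nonpos (by linarith)]
    rw [add_sub_cancel_left] at h
    linarith
  rw [← integrableOn_univ, ← Iic_union_Ioi (a := -d),
    ← Ioc_union_Ioi_eq_Ioi (by linarith : -d ≤ (1 : ℝ))]
  exact h_left.union (h_mid.union h_right)

/-- For β ∈ (0,1/2) and s < t, the Fourier transform of
D^β_-𝟙_{(s,t]}(u) = (1/Γ(1-β))[(t-u)₊^{-β} - (s-u)₊^{-β}] satisfies
F[D^β_-𝟙_{(s,t]}](y) = (iy)^β (e^{ity}-e^{isy})/(iy) for y ≠ 0,
with F[f](y) = ∫ e^{iyu} f(u) du and principal branch powers. -/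
theorem stmt2 (β : ℝ) (hβ0 : 0 < β) (hβ : β < 1/2) (s t : ℝ) (hst : s < t)
    (y : ℝ) (hy : y ≠ 0) :
    (∫ u : ℝ, Complex.exp (Complex.I * y * u) *
        (((1 / Real.Gamma (1 - β)) *
          ((max (t - u) 0) ^ (-β) - (max (s - u) 0) ^ (-β)) : ℝ) : ℂ))
      = (Complex.I * y) ^ (β : ℂ) *
          ((Complex.exp (Complex.I * t * y) - Complex.exp (Complex.I * s * y))
            / (Complex.I * y)) := by
  have hΓ : (Real.Gamma (1 - β) : ℂ) ≠ 0 :=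
    Complex.ofReal_ne_zero.2 (Real.Gamma_pos_of_pos (by linarith)).ne'
  set f : ℝ → ℝ := fun u ↦ (1 / Real.Gamma (1 - β)) *
    ((max (t - u) 0) ^ (-β) - (max (s - u) 0) ^ (-β)) with hf
  have hfi : Integrable f := by
    have h := (integrable_max_add_rpow_sub_max_rpow hβ0 (by linarith)
      (sub_pos.2 hst)).comp_sub_left s
    refine (h.const_mul (1 / Real.Gamma (1 - β))).congr (ae_of_all _ fun u ↦ ?_)
    simp only [hf]
    ring_nf
  have h_reg (ε : ℝ) (hε : 0 < ε) :
      ∫ u : ℝ, Complex.exp ((ε + Complex.I * y) * u) * (f u : ℂ) =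
        (ε + Complex.I * y) ^ ((β - 1 : ℝ) : ℂ) *
          (Complex.exp ((ε + Complex.I * y) * t) - Complex.exp ((ε + Complex.I * y) * s)) := by
    have hz : 0 < ((ε : ℂ) + Complex.I * y).re := by simpa using hε
    obtain ⟨ht1, ht2⟩ := integrable_cexp_mul_max_sub_rpow hβ0 (by linarith) hz t
    obtain ⟨hs1, hs2⟩ := integrable_cexp_mul_max_sub_rpow hβ0 (by linarith) hz s
    have h := integral_sub ht1 hs1
    rw [ht2, hs2] at h
    calc _ = ∫ u : ℝ, (1 / Real.Gamma (1 - β) : ℂ) *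
          (Complex.exp ((ε + Complex.I * y) * u) * (((max (t - u) 0) ^ (-β) : ℝ) : ℂ) -
          Complex.exp ((ε + Complex.I * y) * u) * (((max (s - u) 0) ^ (-β) : ℝ) : ℂ)) := by
          refine integral_congr_ae (ae_of_all _ fun u ↦ ?_)
          simp only [hf, Complex.ofReal_mul, Complex.ofReal_sub, Complex.ofReal_div,
            Complex.ofReal_one]
          ring
      _ = _ := by
          rw [integral_const_mul, h]
          field_simp
  have h_lim : Tendsto (fun ε : ℝ ↦ ∫ u : ℝ, Complex.exp ((ε + Complex.I * y) * u) * (f u : ℂ))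
      (𝓝[>] 0) (𝓝 (∫ u : ℝ, Complex.exp (Complex.I * y * u) * (f u : ℂ))) := by
    refine tendsto_integral_filter_of_dominated_convergence
      (fun u ↦ Real.exp |t| * ‖f u‖) ?_ ?_ (hfi.norm.const_mul _) ?_
    · exact Eventually.of_forall fun ε ↦ (Continuous.aestronglyMeasurable (by fun_prop)).mul
        (Complex.continuous_ofReal.comp_aestronglyMeasurable hfi.aestronglyMeasurable)
    · filter_upwards [Ioo_mem_nhdsGT (zero_lt_one (α := ℝ))] with ε hε
      refine ae_of_all _ fun u ↦ ?_
      rw [norm_mul, Complex.norm_exp, Complex.norm_real]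
      rcases le_or_gt u t with hu | hu
      · refine mul_le_mul_of_nonneg_right (Real.exp_le_exp.2 ?_) (norm_nonneg _)
        have h1 : ε * u ≤ ε * |t| := mul_le_mul_of_nonneg_left (hu.trans (le_abs_self t)) hε.1.le
        have h2 : ε * |t| ≤ 1 * |t| := mul_le_mul_of_nonneg_right hε.2.le (abs_nonneg t)
        simpa using h1.trans h2
      · have hfu : f u = 0 := by
          simp [hf, max_eq_right (by linarith : t - u ≤ 0), max_eq_right (by linarith : s - u ≤ 0)]
        simp [hfu]
    · refine ae_of_all _ fun u ↦ Tendsto.mono_left ?_ nhdsWithin_le_nhds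
      exact Continuous.tendsto' (by fun_prop) _ _ (by simp)
  have hslit : Complex.I * y ∈ Complex.slitPlane := Or.inr (by simpa using hy)
  have hIy : Complex.I * y ≠ 0 := Complex.slitPlane_ne_zero hslit
  have h_rhs : Tendsto (fun ε : ℝ ↦ ((ε : ℂ) + Complex.I * y) ^ ((β - 1 : ℝ) : ℂ) *
      (Complex.exp ((ε + Complex.I * y) * t) - Complex.exp ((ε + Complex.I * y) * s)))
      (𝓝[>] 0) (𝓝 ((Complex.I * y) ^ ((β - 1 : ℝ) : ℂ) *
        (Complex.exp (Complex.I * y * t) - Complex.exp (Complex.I * y * s)))) := by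
    refine Tendsto.mono_left ?_ nhdsWithin_le_nhds
    refine Tendsto.mul (Tendsto.cpow ?_ tendsto_const_nhds hslit) ?_
    · exact Continuous.tendsto' (by fun_prop) _ _ (by simp)
    · exact Continuous.tendsto' (by fun_prop) _ _ (by simp)
  have h_eq := tendsto_nhds_unique (h_lim.congr' (by
    filter_upwards [self_mem_nhdsWithin] with ε hε using h_reg ε hε)) h_rhs
  rw [h_eq, Complex.ofReal_sub, Complex.ofReal_one, Complex.cpow_sub _ _ hIy, Complex.cpow_one,
    mul_right_comm Complex.I (y : ℂ) (t : ℂ), mul_right_comm Complex.I (y : ℂ) (s : ℂ)]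
  ring
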